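/- arXiv:2507.08433 — 2 statements merged into one kernel-verified Lean document; each statement's English description precedes it below -/
import Mathlib

section
/- Let r ≥ t be positive integers and let k be an integer with r < k ≤ r + t − 2 such that k and r + t have the same parity (i.e., k ≡ r + t (mod 2)). Then msad_k(K_{r,t}) = r + t − k; that is, K_{r,t} has a k-multiset antiresolving set of cardinality r + t − k, and every k-multiset antiresolving set of K_{r,t} has cardinality at least r + t − k. -/
open Finset

/-- The multiset representation of `v` with respect to `S`:
the multiset of distances from `v` to the vertices of `S`, counted with multiplicity. -/
noncomputable def mrep {V : Type*} (G : SimpleGraph V) (S : Finset V) (v : V) : Multiset ℕ :=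
  S.val.map (fun s => G.dist v s)

open scoped Classical in
/-- The set of vertices outside `S` having the same multiset representation as `u`. -/
noncomputable def mclass {V : Type*} [Fintype V] (G : SimpleGraph V) (S : Finset V)
    (u : V) : Finset V :=
  Finset.univ.filter (fun v => v ∉ S ∧ mrep G S v = mrep G S u)

open scoped Classical in
/-- `S` is a `k`-multiset antiresolving set (`k`-MARS) of `G`: `S` is nonempty, its complement
is nonempty, and `k` is the largest integer such that every vertex `u ∉ S` has at least `k`
vertices outside `S` (including itself) with its same multiset representation. -/
def IsMARS {V : Type*} [Fintype V] (G : SimpleGraph V) (S : Finset V) (k : ℕ) : Prop :=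
  S.Nonempty ∧ Sᶜ.Nonempty ∧
    (∀ u ∉ S, k ≤ (mclass G S u).card) ∧ (∃ u ∉ S, (mclass G S u).card = k)

/-- `msad_k(G) = m`: `G` has a `k`-multiset antiresolving set of cardinality `m`, and every
`k`-multiset antiresolving set of `G` has cardinality at least `m`. -/
def MsadEq {V : Type*} [Fintype V] (G : SimpleGraph V) (k m : ℕ) : Prop :=
  (∃ S : Finset V, IsMARS G S k ∧ S.card = m) ∧
    ∀ S : Finset V, IsMARS G S k → m ≤ S.card

lemma mclass_subset_compl {V : Type*} [Fintype V] [DecidableEq V] (G : SimpleGraph V)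
    (S : Finset V) (u : V) : mclass G S u ⊆ Sᶜ := by
  intro v hv
  simp only [mclass, mem_filter] at hv
  exact mem_compl.2 hv.2.1

/-- If all vertices outside `S` have the same representation, they form a single class. -/
lemma mclass_eq_compl {V : Type*} [Fintype V] [DecidableEq V] {G : SimpleGraph V}
    {S : Finset V} {m : Multiset ℕ} (h : ∀ v ∉ S, mrep G S v = m) {u : V} (hu : u ∉ S) :
    mclass G S u = Sᶜ :=
  (mclass_subset_compl G S u).antisymm fun v hv => by
    have hv := mem_compl.1 hv
    simp [mclass, hv, h v hv, h u hu]

/-- If all vertices outside `S` have the same representation, then `S` is a `k`-MARS for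
`k = |V ∖ S|`. -/
lemma isMARS_of_mrep_eq {V : Type*} [Fintype V] [DecidableEq V] {G : SimpleGraph V}
    {S : Finset V} {m : Multiset ℕ} (hS : S.Nonempty) (hSc : Sᶜ.Nonempty)
    (h : ∀ v ∉ S, mrep G S v = m) : IsMARS G S Sᶜ.card := by
  obtain ⟨u, hu⟩ := hSc
  have hu' := mem_compl.1 hu
  exact ⟨hS, ⟨u, by simpa using hu'⟩, fun v hv => (mclass_eq_compl h hv).symm ▸ le_rfl, u, hu',
    by rw [mclass_eq_compl h hu']⟩

lemma SimpleGraph.dist_eq_two_of_common_neighbor {V : Type*} {G : SimpleGraph V} {u v w : V}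
    (huv : u ≠ v) (hadj : ¬ G.Adj u v) (huw : G.Adj u w) (hwv : G.Adj w v) :
    G.dist u v = 2 := by
  have hle := SimpleGraph.dist_le (SimpleGraph.Walk.cons huw hwv.toWalk)
  have h₀ := (huw.reachable.trans hwv.reachable).pos_dist_of_ne huv
  have h₁ : G.dist u v ≠ 1 := fun h => hadj (SimpleGraph.dist_eq_one_iff_adj.1 h)
  simp at hle
  omega

lemma mrep_completeBipartiteGraph_inl {α β : Type*} {A : Finset α} {B : Finset β} {x : α}
    [Nonempty β] (hx : x ∉ A) :
    mrep (completeBipartiteGraph α β) (A.disjSum B) (Sum.inl x) =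
      Multiset.replicate A.card 2 + Multiset.replicate B.card 1 := by
  obtain ⟨b⟩ := ‹Nonempty β›
  rw [mrep, val_disjSum, Multiset.disjSum, Multiset.map_add, Multiset.map_map, Multiset.map_map]
  congr 1
  · rw [← Finset.card_val, ← Multiset.map_const']
    refine Multiset.map_congr rfl fun y hy => ?_
    refine SimpleGraph.dist_eq_two_of_common_neighbor (w := Sum.inr b) ?_ ?_ ?_ ?_
    · rintro h
      exact hx (Sum.inl_injective h ▸ hy)
    all_goals simp
  · rw [← Finset.card_val, ← Multiset.map_const']
    exact Multiset.map_congr rfl fun y _ => SimpleGraph.dist_eq_one_iff_adj.2 (by simp)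

lemma mrep_completeBipartiteGraph_inr {α β : Type*} {A : Finset α} {B : Finset β} {x : β}
    [Nonempty α] (hx : x ∉ B) :
    mrep (completeBipartiteGraph α β) (A.disjSum B) (Sum.inr x) =
      Multiset.replicate A.card 1 + Multiset.replicate B.card 2 := by
  obtain ⟨a⟩ := ‹Nonempty α›
  rw [mrep, val_disjSum, Multiset.disjSum, Multiset.map_add, Multiset.map_map, Multiset.map_map]
  congr 1
  · rw [← Finset.card_val, ← Multiset.map_const']
    exact Multiset.map_congr rfl fun y _ => SimpleGraph.dist_eq_one_iff_adj.2 (by simp)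
  · rw [← Finset.card_val, ← Multiset.map_const']
    refine Multiset.map_congr rfl fun y hy => ?_
    refine SimpleGraph.dist_eq_two_of_common_neighbor (w := Sum.inl a) ?_ ?_ ?_ ?_
    · rintro h
      exact hx (Sum.inr_injective h ▸ hy)
    all_goals simp

/-- If `A` and `B` have the same cardinality, all vertices outside `A ∪ B` have the same
representation. -/
lemma mrep_completeBipartiteGraph_of_card_eq {α β : Type*} [Nonempty α] [Nonempty β]
    {A : Finset α} {B : Finset β} (h : A.card = B.card) (v : α ⊕ β) (hv : v ∉ A.disjSum B) :
    mrep (completeBipartiteGraph α β) (A.disjSum B) v =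
      Multiset.replicate A.card 1 + Multiset.replicate A.card 2 := by
  rcases v with x | x
  · rw [mrep_completeBipartiteGraph_inl (by simpa using hv), ← h, add_comm]
  · rw [mrep_completeBipartiteGraph_inr (by simpa using hv), ← h]

/-- If `A` and `B` have different cardinalities, vertices outside `A ∪ B` in different parts have
different representations. -/
lemma mrep_completeBipartiteGraph_inl_ne_inr {α β : Type*} [Nonempty α] [Nonempty β]
    {A : Finset α} {B : Finset β} (h : A.card ≠ B.card) {x : α} {y : β} (hx : x ∉ A)
    (hy : y ∉ B) :
    mrep (completeBipartiteGraph α β) (A.disjSum B) (Sum.inl x) ≠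
      mrep (completeBipartiteGraph α β) (A.disjSum B) (Sum.inr y) := by
  rw [mrep_completeBipartiteGraph_inl hx, mrep_completeBipartiteGraph_inr hy]
  intro heq
  have hcount := congrArg (Multiset.count 1) heq
  simp [Multiset.count_replicate] at hcount
  exact h hcount.symm

lemma card_mclass_completeBipartiteGraph_le {α β : Type*} [Fintype α] [Fintype β] [Nonempty α]
    [Nonempty β] {A : Finset α} {B : Finset β} (h : A.card ≠ B.card) {u : α ⊕ β}
    (hu : u ∉ A.disjSum B) :
    (mclass (completeBipartiteGraph α β) (A.disjSum B) u).card ≤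
      max (Fintype.card α) (Fintype.card β) := by
  rcases u with x | x
  · refine le_max_of_le_left ((card_le_card (t := univ.map Function.Embedding.inl) ?_).trans
      (by simp))
    rintro (y | y) hy
    · simp
    · simp only [mclass, mem_filter] at hy
      exact absurd hy.2.2.symm (mrep_completeBipartiteGraph_inl_ne_inr h (by simpa using hu)
        (by simpa using hy.2.1))
  · refine le_max_of_le_right ((card_le_card (t := univ.map Function.Embedding.inr) ?_).trans
      (by simp))
    rintro (y | y) hy
    · simp only [mclass, mem_filter] at hy
      exact absurd hy.2.2 (mrep_completeBipartiteGraph_inl_ne_inr h (by simpa using hy.2.1)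
        (by simpa using hu))
    · simp

/-- A `k`-MARS of a complete bipartite graph with `k` larger than both parts has exactly `k`
vertices in its complement. -/
lemma IsMARS.card_add_eq_of_completeBipartiteGraph {α β : Type*} [Fintype α] [Fintype β]
    [Nonempty α] [Nonempty β] {S : Finset (α ⊕ β)} {k : ℕ}
    (hS : IsMARS (completeBipartiteGraph α β) S k)
    (hk : max (Fintype.card α) (Fintype.card β) < k) :
    S.card + k = Fintype.card α + Fintype.card β := by
  classical
  obtain ⟨-, -, -, u, hu, rfl⟩ := hS
  rw [← toLeft_disjSum_toRight (u := S)] at hu hk ⊢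
  by_cases h : S.toLeft.card = S.toRight.card
  · rw [mclass_eq_compl (mrep_completeBipartiteGraph_of_card_eq h) hu, card_add_card_compl,
      Fintype.card_sum]
  · exact absurd (card_mclass_completeBipartiteGraph_le h hu) hk.not_ge

/-- for `r ≥ t ≥ 1` and `r < k ≤ r + t - 2` with `k ≡ r + t (mod 2)`,
`msad_k(K_{r,t}) = r + t - k`. -/
theorem stmt8 (r t k : ℕ) (ht : 1 ≤ t) (hrt : t ≤ r) (hrk : r < k) (hk : k ≤ r + t - 2)
    (hpar : k % 2 = (r + t) % 2) :
    MsadEq (completeBipartiteGraph (Fin r) (Fin t)) k (r + t - k) := by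
  have : Nonempty (Fin r) := ⟨⟨0, by omega⟩⟩
  have : Nonempty (Fin t) := ⟨⟨0, by omega⟩⟩
  refine ⟨?_, fun S hS => ?_⟩
  swap
  · have hcard := hS.card_add_eq_of_completeBipartiteGraph (by simp; omega)
    simp only [Fintype.card_fin] at hcard
    omega
  obtain ⟨a, ha⟩ : ∃ a, r + t - k = 2 * a := ⟨(r + t - k) / 2, by omega⟩
  obtain ⟨A, -, hA⟩ := exists_subset_card_eq (s := (univ : Finset (Fin r))) (n := a)
    (by simp; omega)
  obtain ⟨B, -, hB⟩ := exists_subset_card_eq (s := (univ : Finset (Fin t))) (n := a)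
    (by simp; omega)
  have hcard : (A.disjSum B).card = 2 * a := by rw [card_disjSum]; omega
  have hcompl : (A.disjSum B)ᶜ.card = k := by
    rw [card_compl, hcard, Fintype.card_sum, Fintype.card_fin, Fintype.card_fin]
    omega
  refine ⟨A.disjSum B, ?_, by omega⟩
  exact hcompl ▸ isMARS_of_mrep_eq (card_pos.1 (by omega)) (card_pos.1 (by omega))
    (mrep_completeBipartiteGraph_of_card_eq (hA.trans hB.symm))
end

section
/- For every integer n ≥ 3, the path graph P_n satisfies msad_1(P_n) = 1, and msad_2(P_n) = 1 if n is odd while msad_2(P_n) = 2 if n is even. In particular, if n is even then P_n has no 2-multiset antiresolving set consisting of a single vertex, but has one of cardinality 2. -/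
open Finset

theorem dist_pathGraph {n : ℕ} (u v : Fin n) :
    (SimpleGraph.pathGraph n).dist u v = (u - v : ℕ) + (v - u : ℕ) := by
  have walk_length_ge : ∀ {u v : Fin n} (p : (SimpleGraph.pathGraph n).Walk u v),
      (u - v : ℕ) + (v - u : ℕ) ≤ p.length := by
    intro u v p
    induction p with
    | nil => simp
    | cons h p ih =>
      rw [SimpleGraph.pathGraph_adj] at h
      rw [SimpleGraph.Walk.length_cons]
      omega
  have exists_walk : ∀ (k : ℕ) (u v : Fin n), (u : ℕ) + k = v →
      ∃ p : (SimpleGraph.pathGraph n).Walk u v, p.length = k := by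
    intro k
    induction k with
    | zero =>
      intro u v h
      obtain rfl : u = v := Fin.ext h
      exact ⟨.nil, rfl⟩
    | succ k ih =>
      intro u v h
      obtain ⟨p, hp⟩ := ih ⟨u + 1, by omega⟩ v (by simp only; omega)
      exact ⟨.cons (SimpleGraph.pathGraph_adj.mpr (Or.inl rfl)) p, by simp [hp]⟩
  have dist_le_sub : ∀ u v : Fin n, (u : ℕ) ≤ v →
      (SimpleGraph.pathGraph n).dist u v ≤ (v - u : ℕ) := by
    intro u v h
    obtain ⟨p, hp⟩ := exists_walk (v - u) u v (by omega)
    exact hp ▸ SimpleGraph.dist_le p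
  apply le_antisymm
  · rcases le_total (u : ℕ) v with h | h
    · exact (dist_le_sub u v h).trans (by omega)
    · rw [SimpleGraph.dist_comm]
      exact (dist_le_sub v u h).trans (by omega)
  · obtain ⟨p, hp⟩ := (SimpleGraph.pathGraph_preconnected n u v).exists_walk_length_eq_dist
    exact hp ▸ walk_length_ge p

theorem mem_mclass {V : Type*} [Fintype V] {G : SimpleGraph V} {S : Finset V} {u v : V} :
    v ∈ mclass G S u ↔ v ∉ S ∧ mrep G S v = mrep G S u := by
  simp [mclass]

theorem mem_mclass_pathGraph_singleton {n : ℕ} {a u v : Fin n} :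
    v ∈ mclass (SimpleGraph.pathGraph n) {a} u ↔
      v ≠ a ∧ (v = u ∨ (v + u : ℕ) = 2 * a) := by
  rw [mem_mclass]
  simp only [mrep, mem_singleton, singleton_val,
    Multiset.map_singleton, Multiset.singleton_inj, dist_pathGraph, Fin.ext_iff, ne_eq]
  omega

theorem mem_mclass_pathGraph_ends {n : ℕ} {a b u v : Fin n} (ha : (a : ℕ) = 0)
    (hb : (b + 1 : ℕ) = n) (hab : a ≠ b) :
    v ∈ mclass (SimpleGraph.pathGraph n) {a, b} u ↔
      (v ≠ a ∧ v ≠ b) ∧ (v = u ∨ (v + u : ℕ) = b) := by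
  have hval : ({a, b} : Finset (Fin n)).val = {a, b} := by
    rw [insert_val_of_notMem (by simpa using hab)]
    rfl
  rw [mem_mclass]
  simp only [mrep, mem_insert, mem_singleton, hval,
    Multiset.insert_eq_cons, Multiset.map_cons, Multiset.map_singleton, dist_pathGraph,
    Multiset.cons_eq_cons, Multiset.singleton_inj, Multiset.singleton_eq_cons_iff,
    Fin.ext_iff, ne_eq]
  constructor
  · rintro ⟨h, ⟨h1, h2⟩ | ⟨-, c, ⟨h1, -⟩, h2, -⟩⟩ <;> omega
  · rintro ⟨h, h1⟩
    refine ⟨by omega, ?_⟩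
    by_cases hvu : (v : ℕ) = u
    · left
      omega
    · right
      exact ⟨by omega, 0, ⟨by omega, rfl⟩, by omega, rfl⟩

open scoped Classical in
theorem isMARS_of_forall_card_eq {V : Type*} [Fintype V] {G : SimpleGraph V} {S : Finset V}
    {k : ℕ} (hS : S.Nonempty) {w : V} (hw : w ∉ S)
    (h : ∀ u ∉ S, (mclass G S u).card = k) : IsMARS G S k :=
  ⟨hS, ⟨w, mem_compl.mpr hw⟩, fun u hu => (h u hu).ge, w, hw, h w hw⟩

theorem isMARS_pathGraph_one {n : ℕ} (hn : 2 ≤ n) :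
    IsMARS (SimpleGraph.pathGraph n) {⟨0, by omega⟩} 1 := by
  refine isMARS_of_forall_card_eq (singleton_nonempty _) (w := ⟨1, hn⟩) (by simp) fun u hu => ?_
  rw [card_eq_one]
  refine ⟨u, ?_⟩
  ext v
  rw [mem_mclass_pathGraph_singleton]
  simp only [mem_singleton, Fin.ext_iff, ne_eq] at hu ⊢
  omega

theorem isMARS_pathGraph_two_of_odd {m : ℕ} (hm : 1 ≤ m) :
    IsMARS (SimpleGraph.pathGraph (2 * m + 1)) {⟨m, by omega⟩} 2 := by
  refine isMARS_of_forall_card_eq (singleton_nonempty _) (w := ⟨0, by omega⟩)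
    (by simp; omega) fun u hu => ?_
  rw [card_eq_two]
  simp only [mem_singleton, Fin.ext_iff] at hu
  refine ⟨u, ⟨2 * m - u, by omega⟩, by simp only [Fin.ext_iff, ne_eq]; omega, ?_⟩
  ext v
  rw [mem_mclass_pathGraph_singleton]
  simp only [mem_singleton, mem_insert, Fin.ext_iff, ne_eq]
  omega

theorem isMARS_pathGraph_two_of_even {n : ℕ} (hn : 3 ≤ n) (he : Even n) :
    IsMARS (SimpleGraph.pathGraph n) {⟨0, by omega⟩, ⟨n - 1, by omega⟩} 2 := by
  obtain ⟨m, rfl⟩ := he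
  refine isMARS_of_forall_card_eq (insert_nonempty _ _) (w := ⟨1, by omega⟩)
    (by simp; omega) fun u hu => ?_
  rw [card_eq_two]
  simp only [mem_singleton, mem_insert, Fin.ext_iff] at hu
  refine ⟨u, ⟨m + m - 1 - u, by omega⟩, by simp only [Fin.ext_iff, ne_eq]; omega, ?_⟩
  ext v
  rw [mem_mclass_pathGraph_ends rfl (by simp only; omega) (by simp; omega)]
  simp only [mem_singleton, mem_insert, Fin.ext_iff, ne_eq]
  omega

theorem not_isMARS_pathGraph_singleton {n : ℕ} (he : Even n) (a : Fin n) :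
    ¬ IsMARS (SimpleGraph.pathGraph n) {a} 2 := by
  rintro ⟨-, -, h, -⟩
  obtain ⟨u, hua, hu⟩ : ∃ u : Fin n, u ≠ a ∧ ∀ v : Fin n, (v + u : ℕ) ≠ 2 * a := by
    obtain ⟨m, rfl⟩ := he
    rcases lt_or_ge (a : ℕ) m with ha | ha
    · refine ⟨⟨m + m - 1, by omega⟩, ?_, fun v => ?_⟩ <;> simp only [Fin.ext_iff, ne_eq] <;> omega
    · refine ⟨⟨0, by omega⟩, ?_, fun v => ?_⟩ <;> simp only [Fin.ext_iff, ne_eq] <;> omega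
  have : Nonempty (Fin n) := ⟨a⟩
  have hle : (mclass (SimpleGraph.pathGraph n) {a} u).card ≤ 1 := by
    rw [card_le_one_iff_subset_singleton]
    refine ⟨u, fun v hv => ?_⟩
    rw [mem_mclass_pathGraph_singleton] at hv
    exact mem_singleton.mpr (hv.2.resolve_right (hu v))
  have := h u (by simpa using hua)
  omega

/-- for every `n ≥ 3`, `msad_1(P_n) = 1`, and `msad_2(P_n) = 1` if `n` is
odd while `msad_2(P_n) = 2` if `n` is even. -/
theorem stmt10 (n : ℕ) (hn : 3 ≤ n) :
    MsadEq (SimpleGraph.pathGraph n) 1 1 ∧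
    (Odd n → MsadEq (SimpleGraph.pathGraph n) 2 1) ∧
    (Even n → MsadEq (SimpleGraph.pathGraph n) 2 2) := by
  refine ⟨⟨⟨_, isMARS_pathGraph_one (by omega), card_singleton _⟩, fun S hS => hS.1.card_pos⟩,
    fun ho => ?_, fun he => ?_⟩
  · obtain ⟨m, rfl⟩ := ho
    exact ⟨⟨_, isMARS_pathGraph_two_of_odd (by omega), card_singleton _⟩,
      fun S hS => hS.1.card_pos⟩
  · refine ⟨⟨_, isMARS_pathGraph_two_of_even hn he, card_pair (by simp; omega)⟩, fun S hS => ?_⟩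
    by_contra! hlt
    have hpos := hS.1.card_pos
    obtain ⟨a, rfl⟩ := card_eq_one.mp (show S.card = 1 by omega)
    exact not_isMARS_pathGraph_singleton he a hS
end
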